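/- Let a, b ∈ ℝ and assume either a ≠ 1, or a = 1 and b ≥ −1. If β : ℤ → ℂ is an admissible symbol for (a, b) normalized so that β(0) = 1, then b = 2 and β(k) = |k|^a for every nonzero integer k. (This is the Fourier-multiplier instance of the main result: if m_t + u m_x + b u_x m = 0, m = Λ^a_μ u = (−Δ)^{a/2}u + ∫u, is the Euler equation on Diff^∞(S^1) with respect to the metric induced by a Fourier-type inertia operator A, then b = 2 and A = Λ^a_μ.) -/

import Mathlib

/-- The symbol `λ` of the inertia operator `Λ^a_μ = (−Δ)^{a/2} + μ(·)`:
`λ(0) = 1` and `λ(m) = |m|^a` (real power) for `m ≠ 0`. -/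
noncomputable def lamSymbol (a : ℝ) (m : ℤ) : ℝ := if m = 0 then 1 else |(m : ℝ)| ^ a

/-- `β : ℤ → ℂ` is an admissible symbol for `(a, b)`: `β k ≠ 0` for all `k`, and for all `j, k`,
`λ(j+k)·(β j·(2k+j) + β k·(2j+k)) = β (j+k)·(b·(k·λ(j) + j·λ(k)) + k·λ(k) + j·λ(j))`. -/
def AdmissibleSymbol (a b : ℝ) (β : ℤ → ℂ) : Prop :=
  (∀ k : ℤ, β k ≠ 0) ∧
  (∀ j k : ℤ,
    (lamSymbol a (j + k) : ℂ) *
        (β j * (2 * (k : ℂ) + (j : ℂ)) + β k * (2 * (j : ℂ) + (k : ℂ))) =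
      β (j + k) *
        ((b * ((k : ℝ) * lamSymbol a j + (j : ℝ) * lamSymbol a k) +
            (k : ℝ) * lamSymbol a k + (j : ℝ) * lamSymbol a j : ℝ) : ℂ))

theorem lamSymbol_ne_zero (a : ℝ) (m : ℤ) : lamSymbol a m ≠ 0 := by
  unfold lamSymbol
  split_ifs with h
  · exact one_ne_zero
  · exact (Real.rpow_pos_of_pos (abs_pos.mpr (Int.cast_ne_zero.mpr h)) a).ne'

/-- The equation at `k = 0` determines an admissible symbol up to the factor `b / 2`. -/
theorem AdmissibleSymbol.mul_eq_two_mul_lamSymbol {a b : ℝ} {β : ℤ → ℂ}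
    (hβ : AdmissibleSymbol a b β) (hnorm : β 0 = 1) {j : ℤ} (hj : j ≠ 0) :
    (b : ℂ) * β j = 2 * (lamSymbol a j : ℂ) := by
  have h := hβ.2 j 0
  have h0 : lamSymbol a 0 = 1 := by simp [lamSymbol]
  have hj' : (j : ℂ) ≠ 0 := Int.cast_ne_zero.mpr hj
  rw [add_zero, hnorm, h0] at h
  push_cast at h
  apply mul_left_cancel₀ hj'
  linear_combination -h

/-- The equation at `j = k = 1` forces `b = 2`. -/
theorem AdmissibleSymbol.eq_two {a b : ℝ} {β : ℤ → ℂ}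
    (hβ : AdmissibleSymbol a b β) (hnorm : β 0 = 1) : b = 2 := by
  have h1 := hβ.mul_eq_two_mul_lamSymbol hnorm (j := 1) one_ne_zero
  have h2 := hβ.mul_eq_two_mul_lamSymbol hnorm (j := 2) two_ne_zero
  have h := hβ.2 1 1
  have hl : lamSymbol a 1 = 1 := by simp [lamSymbol]
  have hL : (lamSymbol a 2 : ℂ) ≠ 0 :=
    Complex.ofReal_ne_zero.mpr (lamSymbol_ne_zero a 2)
  rw [one_add_one_eq_two, hl] at h
  rw [hl] at h1
  push_cast at h h1
  have hb : (b : ℂ) = (2 : ℝ) := by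
    apply mul_left_cancel₀ hL
    push_cast
    linear_combination
      (-(b : ℂ) * h + 6 * (lamSymbol a 2 : ℂ) * h1 - (2 * b + 2) * h2) / 4
  exact_mod_cast hb


theorem main_metric_realization (a b : ℝ) (hab : a ≠ 1 ∨ (a = 1 ∧ -1 ≤ b))
    (β : ℤ → ℂ) (hβ : AdmissibleSymbol a b β) (hnorm : β 0 = 1) :
    b = 2 ∧ ∀ k : ℤ, k ≠ 0 → β k = ((|(k : ℝ)| ^ a : ℝ) : ℂ) := by
  obtain rfl : b = 2 := hβ.eq_two hnorm
  refine ⟨rfl, fun k hk => ?_⟩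
  have h := hβ.mul_eq_two_mul_lamSymbol hnorm hk
  rw [lamSymbol, if_neg hk, Complex.ofReal_ofNat] at h
  exact mul_left_cancel₀ two_ne_zero h
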